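/- arXiv:1711.11330 — 2 statements merged into one kernel-verified Lean document; each statement's English description precedes it below -/
import Mathlib

section
/- On the kernel space W_h^{00} = V_h^0 × H_0^h(div0, Ω), the trilinear form a_s of the reduced mixed formulation is coercive: there exists a constant γ > 0 such that a_s(ξ_h; ξ_h, ξ_h) ≥ γ ‖ξ_h‖_W² for all ξ_h ∈ W_h^{00}. -/
open scoped RealInnerProductSpace
open Filter Topology

noncomputable section

/-- Abstract functional-analytic model of the relevant function spaces on a
bounded contractible Lipschitz polyhedron `Ω ⊂ ℝ³`.  The Hilbert space `H`
plays the role of `L²(Ω)³` (vector fields), `S` of `L²(Ω)` (scalar fields) and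
`G` of `L²(Ω)^{3×3}` (matrix fields, the targets of the gradient of a vector
field).  The structure carries the `L³`, `L⁶`, `L^∞` and `H^s` norms, the weak
differential operators, the pointwise cross product, the convection form and
the various Sobolev subspaces used in the paper. -/
structure OmegaSetting where
  H : Type
  S : Type
  G : Type
  [nH : NormedAddCommGroup H]
  [iH : InnerProductSpace ℝ H]
  [nS : NormedAddCommGroup S]
  [iS : InnerProductSpace ℝ S]
  [nG : NormedAddCommGroup G]
  [iG : InnerProductSpace ℝ G]
  /-- the `L³(Ω)` norm of a vector field -/
  norm3 : H → ℝ
  norm3_nonneg : ∀ x, 0 ≤ norm3 x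
  /-- the `L⁶(Ω)` norm of a vector field -/
  norm6 : H → ℝ
  norm6_nonneg : ∀ x, 0 ≤ norm6 x
  /-- the `L^∞(Ω)` norm of a vector field -/
  normInf : H → ℝ
  normInf_nonneg : ∀ x, 0 ≤ normInf x
  /-- the `H^s(Ω)³` Sobolev norm of a vector field -/
  sobolevNorm : ℝ → H → ℝ
  sobolevNorm_nonneg : ∀ s x, 0 ≤ sobolevNorm s x
  /-- membership of a vector field in `H^s(Ω)³` -/
  memSobolev : ℝ → H → Prop
  /-- membership of a scalar field in `H^s(Ω)` -/
  memSobolevS : ℝ → S → Prop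
  /-- the weak (distributional) curl operator -/
  curl : H →ₗ[ℝ] H
  /-- the weak (distributional) divergence operator -/
  dive : H →ₗ[ℝ] S
  /-- the weak gradient of a vector field -/
  grad : H →ₗ[ℝ] G
  /-- the pointwise cross product of vector fields -/
  cross : H →ₗ[ℝ] H →ₗ[ℝ] H
  cross_antisymm : ∀ a b, cross a b = - cross b a
  /-- the scalar triple product identity `(a × b, c) = (b, c × a)` in `L²(Ω)` -/
  cross_triple : ∀ a b c, ⟪cross a b, c⟫ = ⟪b, cross c a⟫
  /-- the convection form: `conv w u v` stands for `((w·∇)u, v)` -/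
  conv : H → H → H → ℝ
  /-- `H(curl, Ω)` -/
  Hcurl : Submodule ℝ H
  /-- `H₀(curl, Ω)` (vanishing tangential trace) -/
  Hcurl0 : Submodule ℝ H
  Hcurl0_le : Hcurl0 ≤ Hcurl
  /-- `H(div, Ω)` -/
  Hdiv : Submodule ℝ H
  /-- `H₀(div, Ω)` (vanishing normal trace) -/
  Hdiv0 : Submodule ℝ H
  Hdiv0_le : Hdiv0 ≤ Hdiv
  /-- `H¹₀(Ω)³` -/
  H10 : Submodule ℝ H
  /-- `L²₀(Ω)`, the mean-value-free scalar fields -/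
  L20 : Submodule ℝ S

attribute [instance] OmegaSetting.nH OmegaSetting.iH OmegaSetting.nS
  OmegaSetting.iS OmegaSetting.nG OmegaSetting.iG

/-- the trilinear convection form `L(w; u, v) = ½[((w·∇)u, v) − ((w·∇)v, u)]`. -/
def OmegaSetting.Ltri (Ω : OmegaSetting) (w u v : Ω.H) : ℝ :=
  (Ω.conv w u v - Ω.conv w v u) / 2

/-- Finite element spaces on a regular, quasi-uniform triangulation `T_h` of
`Ω` with mesh size `h`:  a stable Stokes pair `V_h × Q_h` for the fluid
variables together with the spaces `H₀ʰ(curl, Ω)`, `H₀ʰ(div, Ω)`, `L²₀ʰ` from a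
single discrete de Rham sequence with homogeneous boundary conditions, with
commuting projections `Π^curl`, `Π^div`, the discrete (weak) curl `∇_h ×` and
the `L²` projection `ℙ` onto `H₀ʰ(curl, Ω)`. -/
structure FESpacesBC (Ω : OmegaSetting) where
  /-- the mesh size -/
  h : ℝ
  h_pos : 0 < h
  /-- the discrete velocity space `V_h ⊂ H¹₀(Ω)³` -/
  Vh : Submodule ℝ Ω.H
  Vh_le : Vh ≤ Ω.H10
  /-- the discrete pressure space `Q_h` -/
  Qh : Submodule ℝ Ω.S
  Qh_le : Qh ≤ Ω.L20
  /-- `H₀ʰ(curl, Ω)` -/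
  HcurlH : Submodule ℝ Ω.H
  HcurlH_le : HcurlH ≤ Ω.Hcurl0
  /-- `H₀ʰ(div, Ω)` -/
  HdivH : Submodule ℝ Ω.H
  HdivH_le : HdivH ≤ Ω.Hdiv0
  /-- `L²₀ʰ` -/
  L2h : Submodule ℝ Ω.S
  L2h_le : L2h ≤ Ω.L20
  [findimV : FiniteDimensional ℝ Vh]
  [findimQ : FiniteDimensional ℝ Qh]
  [findimC : FiniteDimensional ℝ HcurlH]
  [findimD : FiniteDimensional ℝ HdivH]
  [findimL : FiniteDimensional ℝ L2h]
  /-- complex property: `∇× H₀ʰ(curl) ⊆ H₀ʰ(div)` -/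
  curl_maps : ∀ F ∈ HcurlH, Ω.curl F ∈ HdivH
  /-- `∇· H₀ʰ(div) ⊆ L²₀ʰ` -/
  div_maps : ∀ C ∈ HdivH, Ω.dive C ∈ L2h
  /-- exactness: `∇· H₀ʰ(div, Ω) = L²₀ʰ` -/
  div_surj : ∀ s ∈ L2h, ∃ C ∈ HdivH, Ω.dive C = s
  /-- the discrete (weak) curl operator `∇_h ×` -/
  dcurl : Ω.H →ₗ[ℝ] Ω.H
  dcurl_mem : ∀ C ∈ HdivH, dcurl C ∈ HcurlH
  /-- `(∇_h × C, F) = (C, ∇ × F)` for all `F ∈ H₀ʰ(curl, Ω)` -/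
  dcurl_spec : ∀ C ∈ HdivH, ∀ F ∈ HcurlH, ⟪dcurl C, F⟫ = ⟪C, Ω.curl F⟫
  /-- the commuting projection `Π^curl` -/
  Pcurl : Ω.H →ₗ[ℝ] Ω.H
  Pcurl_mem : ∀ x, Pcurl x ∈ HcurlH
  Pcurl_proj : ∀ x ∈ HcurlH, Pcurl x = x
  /-- the commuting projection `Π^div` -/
  Pdiv : Ω.H →ₗ[ℝ] Ω.H
  Pdiv_mem : ∀ x, Pdiv x ∈ HdivH
  Pdiv_proj : ∀ x ∈ HdivH, Pdiv x = x
  /-- commutativity of the diagram: `Π^div (∇ × x) = ∇ × (Π^curl x)` -/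
  proj_comm : ∀ x, Pdiv (Ω.curl x) = Ω.curl (Pcurl x)
  /-- the `L²` projection `ℙ` onto `H₀ʰ(curl, Ω)` -/
  P : Ω.H →ₗ[ℝ] Ω.H
  P_mem : ∀ x, P x ∈ HcurlH
  P_spec : ∀ x, ∀ F ∈ HcurlH, ⟪P x, F⟫ = ⟪x, F⟫

/-- the product norm `‖(u, B)‖_W` on `W_h = V_h × H₀ʰ(div, Ω)`:
`‖(u,B)‖_W² = ‖u‖₁² + ‖B‖_d²` with `‖B‖_d² = ‖B‖² + ‖∇·B‖² + ‖∇_h×B‖²`. -/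
def normW (Ω : OmegaSetting) (Th : FESpacesBC Ω) (u B : Ω.H) : ℝ :=
  Real.sqrt (‖u‖ ^ 2 + ‖Ω.grad u‖ ^ 2 + ‖B‖ ^ 2 + ‖Ω.dive B‖ ^ 2
    + ‖Th.dcurl B‖ ^ 2)

/-- the product norm `‖(q, s)‖_Y` on `Y_h = Q_h × L²₀ʰ`. -/
def normY (Ω : OmegaSetting) (q s : Ω.S) : ℝ :=
  Real.sqrt (‖q‖ ^ 2 + ‖s‖ ^ 2)

/-- the norm `‖(v, F, C)‖_X` on `X_h`, relative to a given field `B⁻`: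
`‖(v,F,C)‖_X² = ‖v‖² + ‖∇v‖² + ‖∇×F‖² + ‖F + v×B⁻‖² + ‖C‖² + ‖∇·C‖²`. -/
def normX (Ω : OmegaSetting) (Bprev v F C : Ω.H) : ℝ :=
  Real.sqrt (‖v‖ ^ 2 + ‖Ω.grad v‖ ^ 2 + ‖Ω.curl F‖ ^ 2
    + ‖F + Ω.cross v Bprev‖ ^ 2 + ‖C‖ ^ 2 + ‖Ω.dive C‖ ^ 2)

/-- the trilinear form `a_s(ψ; ξ, η)` of the reduced mixed formulation, with
`ψ = (w, G)`, `ξ = (u, B)`, `η = (v, C)` and `α = S·R_m⁻¹`. -/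
def aS (Ω : OmegaSetting) (Th : FESpacesBC Ω) (Re Rm Sc : ℝ)
    (w Gm u Bm v Cm : Ω.H) : ℝ :=
  Ω.Ltri w u v + Re⁻¹ * ⟪Ω.grad u, Ω.grad v⟫
    - (Sc / Rm) * ⟪Th.dcurl Bm, Ω.cross Gm v⟫
    + Sc * ⟪Ω.cross u Gm - Th.P (Ω.cross u Gm),
            Ω.cross v Gm - Th.P (Ω.cross v Gm)⟫
    - (Sc / Rm) * ⟪Ω.cross u Gm, Th.dcurl Cm⟫
    + (Sc / Rm ^ 2) * ⟪Th.dcurl Bm, Th.dcurl Cm⟫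

/-- the bilinear form `b_s((v, C), (q, s)) = −(∇·v, q) + (∇·C, s)`. -/
def bS (Ω : OmegaSetting) (v Cm : Ω.H) (q s : Ω.S) : ℝ :=
  - ⟪Ω.dive v, q⟫ + ⟪Ω.dive Cm, s⟫

/-- the bilinear form `a_{s,L}(U, V)` of one linearized (Picard) step, with
`U = (u, E, B)`, `V = (v, F, C)` and given `(u⁻, B⁻)`. -/
def aSL (Ω : OmegaSetting) (Re Rm Sc : ℝ) (uprev Bprev : Ω.H)
    (u E Bm v F Cm : Ω.H) : ℝ :=
  (1 / 2) * Ω.Ltri uprev u v + Re⁻¹ * ⟪Ω.grad u, Ω.grad v⟫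
    + Sc * ⟪E + Ω.cross u Bprev, F + Ω.cross v Bprev⟫
    - (Sc / Rm) * ⟪Bm, Ω.curl F⟫
    + (Sc / Rm) * ⟪Ω.curl E, Cm⟫

/-- Problem 1: the `B`–`E` based finite element scheme for the stationary MHD
system with boundary conditions `u = 0`, `B·n = 0`, `E×n = 0`, with
`j_h = E_h + u_h × B_h` and `α = S·R_m⁻¹`. -/
structure IsProblem1Solution (Ω : OmegaSetting) (Th : FESpacesBC Ω)
    (Re Rm Sc : ℝ) (f : Ω.H →ₗ[ℝ] ℝ) (u E B : Ω.H) (p r : Ω.S) : Prop where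
  hu : u ∈ Th.Vh
  hE : E ∈ Th.HcurlH
  hB : B ∈ Th.HdivH
  hp : p ∈ Th.Qh
  hr : r ∈ Th.L2h
  momentum : ∀ v ∈ Th.Vh,
    Ω.Ltri u u v + Re⁻¹ * ⟪Ω.grad u, Ω.grad v⟫
      - Sc * ⟪Ω.cross (E + Ω.cross u B) B, v⟫ - ⟪p, Ω.dive v⟫ = f v
  ohm : ∀ F ∈ Th.HcurlH,
    Sc * ⟪E + Ω.cross u B, F⟫ - (Sc / Rm) * ⟪B, Ω.curl F⟫ = 0
  faraday : ∀ C ∈ Th.HdivH,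
    (Sc / Rm) * ⟪Ω.curl E, C⟫ + ⟪r, Ω.dive C⟫ = 0
  incomp : ∀ q ∈ Th.Qh, ⟪Ω.dive u, q⟫ = 0
  gauss : ∀ s ∈ Th.L2h, ⟪Ω.dive B, s⟫ = 0

/-- One step of the Picard iteration (Algorithm 1) for Problem 1: given
`(u⁻, B⁻) = (uprev, Bprev)`, find `(u, E, B, p, r)`, where
`j = E + u × B⁻`. -/
structure IsPicardStep (Ω : OmegaSetting) (Th : FESpacesBC Ω)
    (Re Rm Sc : ℝ) (f : Ω.H →ₗ[ℝ] ℝ) (uprev Bprev : Ω.H)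
    (u E B : Ω.H) (p r : Ω.S) : Prop where
  hu : u ∈ Th.Vh
  hE : E ∈ Th.HcurlH
  hB : B ∈ Th.HdivH
  hp : p ∈ Th.Qh
  hr : r ∈ Th.L2h
  momentum : ∀ v ∈ Th.Vh,
    Ω.Ltri uprev u v + Re⁻¹ * ⟪Ω.grad u, Ω.grad v⟫
      - Sc * ⟪Ω.cross (E + Ω.cross u Bprev) Bprev, v⟫
      - ⟪p, Ω.dive v⟫ = f v
  ohm : ∀ F ∈ Th.HcurlH,
    Sc * ⟪E + Ω.cross u Bprev, F⟫ - (Sc / Rm) * ⟪B, Ω.curl F⟫ = 0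
  faraday : ∀ C ∈ Th.HdivH,
    (Sc / Rm) * ⟪Ω.curl E, C⟫ + ⟪r, Ω.dive C⟫ = 0
  incomp : ∀ q ∈ Th.Qh, ⟪Ω.dive u, q⟫ = 0
  gauss : ∀ s ∈ Th.L2h, ⟪Ω.dive B, s⟫ = 0

/-- Problem 3: the augmented finite element scheme without magnetic Lagrange
multiplier, with the augmentation term `α(∇·B_h, ∇·C)`. -/
structure IsProblem3Solution (Ω : OmegaSetting) (Th : FESpacesBC Ω)
    (Re Rm Sc : ℝ) (f : Ω.H →ₗ[ℝ] ℝ) (u E B : Ω.H) (p : Ω.S) : Prop where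
  hu : u ∈ Th.Vh
  hE : E ∈ Th.HcurlH
  hB : B ∈ Th.HdivH
  hp : p ∈ Th.Qh
  momentum : ∀ v ∈ Th.Vh,
    Ω.Ltri u u v + Re⁻¹ * ⟪Ω.grad u, Ω.grad v⟫
      - Sc * ⟪Ω.cross (E + Ω.cross u B) B, v⟫ - ⟪p, Ω.dive v⟫ = f v
  ohm : ∀ F ∈ Th.HcurlH,
    Sc * ⟪E + Ω.cross u B, F⟫ - (Sc / Rm) * ⟪B, Ω.curl F⟫ = 0
  faraday : ∀ C ∈ Th.HdivH,
    (Sc / Rm) * ⟪Ω.curl E, C⟫ + (Sc / Rm) * ⟪Ω.dive B, Ω.dive C⟫ = 0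
  incomp : ∀ q ∈ Th.Qh, ⟪Ω.dive u, q⟫ = 0

/-- One step of the Picard iteration for the augmented scheme without
magnetic Lagrange multiplier, with `jⁿ_{n−1} = Eⁿ + uⁿ × B^{n−1}`. -/
structure IsPicardStep3 (Ω : OmegaSetting) (Th : FESpacesBC Ω)
    (Re Rm Sc : ℝ) (f : Ω.H →ₗ[ℝ] ℝ) (uprev Bprev : Ω.H)
    (u E B : Ω.H) (p : Ω.S) : Prop where
  hu : u ∈ Th.Vh
  hE : E ∈ Th.HcurlH
  hB : B ∈ Th.HdivH
  hp : p ∈ Th.Qh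
  momentum : ∀ v ∈ Th.Vh,
    Ω.Ltri uprev u v + Re⁻¹ * ⟪Ω.grad u, Ω.grad v⟫
      - Sc * ⟪Ω.cross (E + Ω.cross u Bprev) Bprev, v⟫
      - ⟪p, Ω.dive v⟫ = f v
  ohm : ∀ F ∈ Th.HcurlH,
    Sc * ⟪E + Ω.cross u Bprev, F⟫ - (Sc / Rm) * ⟪B, Ω.curl F⟫ = 0
  faraday : ∀ C ∈ Th.HdivH,
    (Sc / Rm) * ⟪Ω.curl E, C⟫ + (Sc / Rm) * ⟪Ω.dive B, Ω.dive C⟫ = 0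
  incomp : ∀ q ∈ Th.Qh, ⟪Ω.dive u, q⟫ = 0

/-- The exact (weak) solution of the stationary MHD system with boundary
conditions `u = 0`, `B·n = 0`, `E×n = 0`, with `j = E + u × B = R_m⁻¹ ∇×B`. -/
structure IsExactSolutionBC (Ω : OmegaSetting) (Re Rm Sc : ℝ)
    (f : Ω.H →ₗ[ℝ] ℝ) (u E B : Ω.H) (p : Ω.S) : Prop where
  hu : u ∈ Ω.H10
  hE : E ∈ Ω.Hcurl0
  hB : B ∈ Ω.Hdiv0
  hp : p ∈ Ω.L20
  momentum : ∀ v ∈ Ω.H10,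
    Ω.Ltri u u v + Re⁻¹ * ⟪Ω.grad u, Ω.grad v⟫
      - Sc * ⟪Ω.cross (E + Ω.cross u B) B, v⟫ - ⟪p, Ω.dive v⟫ = f v
  ohm : E + Ω.cross u B = Rm⁻¹ • Ω.curl B
  faraday : Ω.curl E = 0
  gauss : Ω.dive B = 0
  incomp : Ω.dive u = 0

/-- The (minimal) regularity assumption (4.1) of the paper:
`u ∈ H^{1+σ}(Ω)³`, `B, ∇×B, E ∈ H^σ(Ω)³`, `p ∈ H^σ(Ω) ∩ L²₀(Ω)`, `σ > 1/2`. -/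
def RegularityAssumption (Ω : OmegaSetting) (σ : ℝ)
    (u E B : Ω.H) (p : Ω.S) : Prop :=
  1 / 2 < σ ∧ Ω.memSobolev (1 + σ) u ∧ Ω.memSobolev σ B ∧
    Ω.memSobolev σ (Ω.curl B) ∧ Ω.memSobolev σ E ∧
    Ω.memSobolevS σ p ∧ p ∈ Ω.L20

/-- On the diagonal, the convection form vanishes and the two coupling terms cancel. -/
theorem aS_diag (Ω : OmegaSetting) (Th : FESpacesBC Ω) (Re Rm Sc : ℝ) (u B : Ω.H) :
    aS Ω Th Re Rm Sc u B u B u B = Re⁻¹ * ‖Ω.grad u‖ ^ 2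
      + Sc * ‖Ω.cross u B - Th.P (Ω.cross u B)‖ ^ 2
      + Sc / Rm ^ 2 * ‖Th.dcurl B‖ ^ 2 := by
  simp only [aS, OmegaSetting.Ltri, Ω.cross_antisymm B u, inner_neg_right,
    real_inner_self_eq_norm_sq, real_inner_comm (Th.dcurl B) (Ω.cross u B)]
  ring

/-- **Lemma (coercivity of `a_s` on the kernel `W_h^{00}`).**
There is `γ > 0` with `a_s(ξ_h; ξ_h, ξ_h) ≥ γ‖ξ_h‖_W²` for all
`ξ_h = (u_h, B_h) ∈ W_h^{00}`. -/
theorem reduced_aS_coercive (Ω : OmegaSetting) (Th : FESpacesBC Ω)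
    (Re Rm Sc : ℝ) (hRe : 0 < Re) (hRm : 0 < Rm) (hSc : 0 < Sc)
    -- the discrete Poincaré inequality on `H₀ʰ(div0, Ω)`:
    (Cp : ℝ) (hCp : 0 < Cp)
    (hpoinc : ∀ B ∈ Th.HdivH, Ω.dive B = 0 → ‖B‖ ≤ Cp * ‖Th.dcurl B‖)
    -- the Poincaré inequality on `H¹₀(Ω)³`:
    (CP : ℝ) (hCP : 0 < CP)
    (hpoincV : ∀ v ∈ Ω.H10, ‖v‖ ≤ CP * ‖Ω.grad v‖) :
    ∃ γ > 0, ∀ u ∈ Th.Vh, (∀ q ∈ Th.Qh, ⟪Ω.dive u, q⟫ = 0) →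
      ∀ B ∈ Th.HdivH, Ω.dive B = 0 →
        γ * normW Ω Th u B ^ 2 ≤ aS Ω Th Re Rm Sc u B u B u B := by
  have ha : 0 < Re⁻¹ / (1 + CP ^ 2) := by positivity
  have hb : 0 < Sc / Rm ^ 2 / (1 + Cp ^ 2) := by positivity
  refine ⟨min (Re⁻¹ / (1 + CP ^ 2)) (Sc / Rm ^ 2 / (1 + Cp ^ 2)), lt_min ha hb, ?_⟩
  intro u hu _ B hB hdiv
  have hu_sq : ‖u‖ ^ 2 ≤ CP ^ 2 * ‖Ω.grad u‖ ^ 2 := by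
    rw [← mul_pow]
    exact pow_le_pow_left₀ (norm_nonneg _) (hpoincV u (Th.Vh_le hu)) 2
  have hB_sq : ‖B‖ ^ 2 ≤ Cp ^ 2 * ‖Th.dcurl B‖ ^ 2 := by
    rw [← mul_pow]
    exact pow_le_pow_left₀ (norm_nonneg _) (hpoinc B hB hdiv) 2
  rw [aS_diag, normW, Real.sq_sqrt (by positivity), hdiv, norm_zero]
  set γ := min (Re⁻¹ / (1 + CP ^ 2)) (Sc / Rm ^ 2 / (1 + Cp ^ 2))
  have hγ_nonneg : 0 ≤ γ := (lt_min ha hb).le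
  have hγ_left : γ * (1 + CP ^ 2) ≤ Re⁻¹ :=
    (le_div_iff₀ (by positivity)).1 (min_le_left _ _)
  have hγ_right : γ * (1 + Cp ^ 2) ≤ Sc / Rm ^ 2 :=
    (le_div_iff₀ (by positivity)).1 (min_le_right _ _)
  calc γ * (‖u‖ ^ 2 + ‖Ω.grad u‖ ^ 2 + ‖B‖ ^ 2 + 0 ^ 2 + ‖Th.dcurl B‖ ^ 2)
      ≤ γ * (CP ^ 2 * ‖Ω.grad u‖ ^ 2 + ‖Ω.grad u‖ ^ 2
          + Cp ^ 2 * ‖Th.dcurl B‖ ^ 2 + 0 ^ 2 + ‖Th.dcurl B‖ ^ 2) := by gcongr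
    _ = γ * (1 + CP ^ 2) * ‖Ω.grad u‖ ^ 2 + 0
          + γ * (1 + Cp ^ 2) * ‖Th.dcurl B‖ ^ 2 := by ring
    _ ≤ Re⁻¹ * ‖Ω.grad u‖ ^ 2 + Sc * ‖Ω.cross u B - Th.P (Ω.cross u B)‖ ^ 2
          + Sc / Rm ^ 2 * ‖Th.dcurl B‖ ^ 2 := by
      gcongr
      positivity
end
end

section
/- The bilinear form b_s(·,·) on X_h × Y_h satisfies the inf-sup condition: there exists a constant γ > 0 such that inf_{y ∈ Y_h} sup_{V ∈ X_h} b_s(V, y) / (‖V‖_X ‖y‖_Y) ≥ γ. -/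
open scoped RealInnerProductSpace
open Filter Topology

noncomputable section

/-- A linear map is bounded on a finite-dimensional subspace. -/
lemma exists_norm_map_le_of_finiteDimensional {E F : Type*}
    [NormedAddCommGroup E] [NormedSpace ℝ E] [NormedAddCommGroup F] [NormedSpace ℝ F]
    (W : Submodule ℝ E) [FiniteDimensional ℝ W] (f : E →ₗ[ℝ] F) :
    ∃ K : ℝ, ∀ x ∈ W, ‖f x‖ ≤ K * ‖x‖ := by
  let g : W →L[ℝ] F := LinearMap.toContinuousLinearMap (f.comp W.subtype)
  exact ⟨‖g‖, fun x hx => g.le_opNorm ⟨x, hx⟩⟩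

/-- **Lemma (inf-sup condition for `b_s` on `X_h × Y_h`).**
There is `γ > 0` with
`inf_{y ∈ Y_h} sup_{V ∈ X_h} b_s(V, y)/(‖V‖_X ‖y‖_Y) ≥ γ`. -/
theorem picard_bS_infsup (Ω : OmegaSetting) (Th : FESpacesBC Ω)
    (Bprev : Ω.H) (hBprev : Bprev ∈ Ω.Hdiv)
    (γ₀ : ℝ) (hγ₀ : 0 < γ₀)
    (hstokes : ∀ q ∈ Th.Qh, ∃ v ∈ Th.Vh, v ≠ 0 ∧
        γ₀ * Real.sqrt (‖v‖ ^ 2 + ‖Ω.grad v‖ ^ 2) * ‖q‖ ≤ - ⟪Ω.dive v, q⟫)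
    (Cd : ℝ) (hCd : 0 < Cd)
    (hdivb : ∀ s ∈ Th.L2h, ∃ Cm ∈ Th.HdivH, Ω.dive Cm = s ∧
        Real.sqrt (‖Cm‖ ^ 2 + ‖Ω.dive Cm‖ ^ 2) ≤ Cd * ‖s‖)
    (hne : ∃ v ∈ Th.Vh, v ≠ 0) :
    ∃ γ > 0, ∀ q ∈ Th.Qh, ∀ s ∈ Th.L2h,
      ∃ v ∈ Th.Vh, ∃ F ∈ Th.HcurlH, ∃ Cm ∈ Th.HdivH,
        ¬(v = 0 ∧ F = 0 ∧ Cm = 0) ∧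
        γ * normX Ω Bprev v F Cm * normY Ω q s ≤ bS Ω v Cm q s := by
  have := Th.findimV
  obtain ⟨K, hK⟩ :=
    exists_norm_map_le_of_finiteDimensional Th.Vh (Ω.cross.flip Bprev)
  simp only [LinearMap.flip_apply] at hK
  have hM : 0 < Real.sqrt (1 + K ^ 2 + Cd ^ 2) := by positivity
  have hm : 0 < min γ₀ 1 := lt_min hγ₀ one_pos
  refine ⟨min γ₀ 1 / Real.sqrt (1 + K ^ 2 + Cd ^ 2), div_pos hm hM, fun q hq s hs => ?_⟩
  by_cases hqs : q = 0 ∧ s = 0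
  · obtain ⟨rfl, rfl⟩ := hqs
    obtain ⟨v, hv, hv0⟩ := hne
    exact ⟨v, hv, 0, Th.HcurlH.zero_mem, 0, Th.HdivH.zero_mem, fun h => hv0 h.1, by
      simp [normY, bS]⟩
  obtain ⟨v, hv, hv0, hvq⟩ := hstokes q hq
  obtain ⟨Cm, hCm, hdiv, hCb⟩ := hdivb s hs
  set n := Real.sqrt (‖v‖ ^ 2 + ‖Ω.grad v‖ ^ 2) with hn
  have hvpos : 0 < ‖v‖ := norm_pos_iff.mpr hv0
  have hnpos : 0 < n := by positivity
  have hnsq : n ^ 2 = ‖v‖ ^ 2 + ‖Ω.grad v‖ ^ 2 := Real.sq_sqrt (by positivity)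
  set t := ‖q‖ / n with ht
  have ht0 : 0 ≤ t := by positivity
  have htn : t * n = ‖q‖ := div_mul_cancel₀ _ hnpos.ne'
  refine ⟨t • v, Th.Vh.smul_mem t hv, 0, Th.HcurlH.zero_mem, Cm, hCm, ?_, ?_⟩
  · rintro ⟨h1, -, h3⟩
    refine hqs ⟨?_, by rw [← hdiv, h3, map_zero]⟩
    rcases smul_eq_zero.mp h1 with h | h
    · rw [← norm_eq_zero, ← htn, h, zero_mul]
    · exact absurd h hv0
  have hY : normY Ω q s ^ 2 = ‖q‖ ^ 2 + ‖s‖ ^ 2 := Real.sq_sqrt (by positivity)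
  have hY0 : 0 ≤ normY Ω q s := Real.sqrt_nonneg _
  have hvel : ‖t • v‖ ^ 2 + ‖Ω.grad (t • v)‖ ^ 2 = ‖q‖ ^ 2 := by
    rw [map_smul, norm_smul, norm_smul, Real.norm_of_nonneg ht0, ← htn]
    linear_combination (-t ^ 2) * hnsq
  have hcross : ‖Ω.cross (t • v) Bprev‖ ^ 2 ≤ K ^ 2 * ‖q‖ ^ 2 := by
    calc ‖Ω.cross (t • v) Bprev‖ ^ 2 ≤ (K * ‖t • v‖) ^ 2 := by
          gcongr
          exact hK _ (Th.Vh.smul_mem t hv)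
      _ = K ^ 2 * ‖t • v‖ ^ 2 := mul_pow _ _ _
      _ ≤ K ^ 2 * ‖q‖ ^ 2 := by
          gcongr ?_ * ?_
          linarith [sq_nonneg ‖Ω.grad (t • v)‖]
  have hmag : ‖Cm‖ ^ 2 + ‖Ω.dive Cm‖ ^ 2 ≤ Cd ^ 2 * ‖s‖ ^ 2 := by
    rw [← mul_pow]
    exact (Real.sqrt_le_left (by positivity)).mp hCb
  have hX : normX Ω Bprev (t • v) 0 Cm
      ≤ Real.sqrt (1 + K ^ 2 + Cd ^ 2) * normY Ω q s := by
    unfold normX normY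
    rw [← Real.sqrt_mul (by positivity)]
    apply Real.sqrt_le_sqrt
    rw [map_zero, norm_zero, zero_add]
    nlinarith [mul_nonneg (sq_nonneg K) (sq_nonneg ‖s‖),
      mul_nonneg (sq_nonneg Cd) (sq_nonneg ‖q‖), sq_nonneg ‖s‖]
  have hb : γ₀ * ‖q‖ ^ 2 + ‖s‖ ^ 2 ≤ bS Ω (t • v) Cm q s := by
    unfold bS
    rw [hdiv, real_inner_self_eq_norm_sq, map_smul, real_inner_smul_left]
    have h := mul_le_mul_of_nonneg_left hvq ht0
    have h' : t * (γ₀ * n * ‖q‖) = γ₀ * ‖q‖ ^ 2 := by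
      linear_combination γ₀ * ‖q‖ * htn
    linarith
  calc min γ₀ 1 / Real.sqrt (1 + K ^ 2 + Cd ^ 2) * normX Ω Bprev (t • v) 0 Cm * normY Ω q s
      ≤ min γ₀ 1 / Real.sqrt (1 + K ^ 2 + Cd ^ 2)
          * (Real.sqrt (1 + K ^ 2 + Cd ^ 2) * normY Ω q s) * normY Ω q s := by gcongr
    _ = min γ₀ 1 * (‖q‖ ^ 2 + ‖s‖ ^ 2) := by
        rw [← hY]
        field_simp
    _ ≤ γ₀ * ‖q‖ ^ 2 + ‖s‖ ^ 2 := by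
        have h1 := mul_le_mul_of_nonneg_right (min_le_left γ₀ 1) (sq_nonneg ‖q‖)
        have h2 := mul_le_mul_of_nonneg_right (min_le_right γ₀ 1) (sq_nonneg ‖s‖)
        linarith
    _ ≤ bS Ω (t • v) Cm q s := hb
end
end
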